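/- The order-four binary function f_{U24} on ground set {a,b,c,d}, defined by f_{U24}(X)=0 for |X| ∈ {1,2}, f_{U24}(X)=1 for |X| ∈ {0,3}, and f_{U24}(X)=−1 for |X|=4, is an excluded minor for the class of linear binary functions: f_{U24} is nonlinear, but every proper minor of f_{U24} is linear. -/

import Mathlib

/-- A binary function on finite ground set `E`: a function `f : 2^E → ℝ` with `f ∅ = 1`.
(The function is defined on all finite sets; only its values on subsets of `E` matter.) -/
structure BinaryFunction (α : Type) [DecidableEq α] where
  E : Finset α
  f : Finset α → ℝ
  empty_one : f ∅ = 1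

namespace BinaryFunction

variable {α : Type} [DecidableEq α]

/-- Contraction of a single element: `(f/e)(Y) = f(Y)` on ground set `E ∖ {e}`. -/
def contract (g : BinaryFunction α) (e : α) : BinaryFunction α :=
  ⟨g.E.erase e, g.f, g.empty_one⟩

/-- Deletion of a single element: `(f∖e)(Y) = (f(Y) + f(Y ∪ {e})) / (1 + f({e}))`
on ground set `E ∖ {e}`; well defined iff `1 + f({e}) ≠ 0` (in which case the
`if` branch below agrees with the formula, since the formula gives `1` at `∅`). -/
noncomputable def delete (g : BinaryFunction α) (e : α) : BinaryFunction α :=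
  ⟨g.E.erase e,
   fun Y => if Y = ∅ then 1 else (g.f Y + g.f (Y ∪ {e})) / (1 + g.f {e}),
   by simp⟩

/-- Contraction of a set: `(f/X)(Y) = f(Y)` on ground set `E ∖ X`. -/
def contractSet (g : BinaryFunction α) (X : Finset α) : BinaryFunction α :=
  ⟨g.E \ X, g.f, g.empty_one⟩

/-- Deletion of a set: `(f∖X)(Y) = (∑_{Z ⊆ X} f(Y ∪ Z)) / (∑_{Z ⊆ X} f(Z))`
on ground set `E ∖ X`; well defined iff `∑_{Z ⊆ X} f(Z) ≠ 0` (in which case the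
`if` branch agrees with the formula, since the formula gives `1` at `∅`). -/
noncomputable def deleteSet (g : BinaryFunction α) (X : Finset α) : BinaryFunction α :=
  ⟨g.E \ X,
   fun Y => if Y = ∅ then 1 else
     (∑ Z ∈ X.powerset, g.f (Y ∪ Z)) / (∑ Z ∈ X.powerset, g.f Z),
   by simp⟩

/-- `IsMinorOf m f`: `m` is obtained from `f` by a sequence of single-element
contractions and deletions, each step being well defined. -/
inductive IsMinorOf : BinaryFunction α → BinaryFunction α → Prop
  | refl (f : BinaryFunction α) : IsMinorOf f f
  | contract {f g : BinaryFunction α} (e : α) (he : e ∈ g.E)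
      (h : IsMinorOf g f) : IsMinorOf (g.contract e) f
  | delete {f g : BinaryFunction α} (e : α) (he : e ∈ g.E)
      (hw : 1 + g.f {e} ≠ 0) (h : IsMinorOf g f) : IsMinorOf (g.delete e) f

/-- `f` is stable: every sequence of single-element contractions and deletions applied
to `f` is well defined at every step, i.e. at every reachable minor `g`, deletion of any
ground-set element is well defined. -/
def Stable (f : BinaryFunction α) : Prop :=
  ∀ g : BinaryFunction α, IsMinorOf g f → ∀ e ∈ g.E, 1 + g.f {e} ≠ 0

/-- Isomorphism of binary functions: a bijection `φ` of ground sets with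
`f(X) = f'(φ(X))` for all `X ⊆ E`. -/
def Isomorphic (g g' : BinaryFunction α) : Prop :=
  ∃ φ : α → α, Set.InjOn φ ↑g.E ∧ g.E.image φ = g'.E ∧
    ∀ X ⊆ g.E, g.f X = g'.f (X.image φ)

/-- `f_α`: the order-one binary function on ground set `{e}` with value `α` on `{e}`. -/
def fAlpha (e : α) (a : ℝ) : BinaryFunction α :=
  ⟨{e}, fun X => if X = ∅ then 1 else a, by simp⟩

/-- The rank function `Qf(X) = log₂((∑_{Y ⊆ E} f(Y)) / (∑_{Y ⊆ E∖X} f(Y)))`. -/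
noncomputable def Q (g : BinaryFunction α) (X : Finset α) : ℝ :=
  Real.logb 2 ((∑ Y ∈ g.E.powerset, g.f Y) / (∑ Y ∈ (g.E \ X).powerset, g.f Y))

/-- `f` is rankable: for every `X ⊆ E` the denominator in `Qf(X)` is nonzero and
the quotient is strictly positive. -/
def Rankable (g : BinaryFunction α) : Prop :=
  ∀ X ⊆ g.E, (∑ Y ∈ (g.E \ X).powerset, g.f Y) ≠ 0 ∧
    0 < (∑ Y ∈ g.E.powerset, g.f Y) / (∑ Y ∈ (g.E \ X).powerset, g.f Y)

/-- `f` is `k`-polymatroidal: rankable, with `Qf` satisfying R0–R3. -/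
def Polymatroidal (k : ℕ) (g : BinaryFunction α) : Prop :=
  Rankable g ∧
  (∀ X ⊆ g.E, ∃ n : ℕ, g.Q X = n) ∧
  (∀ X ⊆ g.E, g.Q X ≤ (k : ℝ) * X.card) ∧
  (∀ X ⊆ g.E, ∀ e ∈ g.E, e ∉ X → g.Q X ≤ g.Q (insert e X)) ∧
  (∀ X ⊆ g.E, ∀ a ∈ g.E, ∀ b ∈ g.E, a ∉ X → b ∉ X → a ≠ b →
    g.Q X + g.Q (insert a (insert b X)) ≤ g.Q (insert a X) + g.Q (insert b X))

/-- `f` is linear: `{0,1}`-valued on subsets of `E`, and closed under symmetric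
difference of supports. -/
def Linear (g : BinaryFunction α) : Prop :=
  (∀ X ⊆ g.E, g.f X = 0 ∨ g.f X = 1) ∧
  (∀ X ⊆ g.E, ∀ Y ⊆ g.E, g.f X = 1 → g.f Y = 1 → g.f (symmDiff X Y) = 1)

/-- The order-two excluded minor `g`: value `1` on sets of size `0,1`, `-1` on size `2`. -/
def gTwo (a b : α) : BinaryFunction α :=
  ⟨{a, b}, fun X => if X.card = 2 then -1 else 1, by simp⟩

/-- The order-four excluded minor `f_{U_{2,4}}`: `1` on sizes `0,3`, `0` on sizes `1,2`,
`-1` on size `4`. -/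
def fU24 (a b c d : α) : BinaryFunction α :=
  ⟨{a, b, c, d},
   fun X => if X.card = 0 then 1 else if X.card ≤ 2 then 0
            else if X.card = 3 then 1 else -1,
   by simp⟩

/-- The order-two excluded minors `f_{α,β,γ}` of the `k`-polymatroidal binary functions. -/
def fABG (a b : α) (p q r : ℕ) : BinaryFunction α :=
  ⟨{a, b},
   fun X =>
     if X = ∅ then 1
     else if X = {a} then 2 ^ (p + r - q + 1) - 1
     else if X = {b} then 2 ^ (r + 1) - 1
     else 2 ^ (p + r + 1) - 2 ^ (r + 1) - 2 ^ (p + r - q + 1) + 1,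
   by simp⟩

end BinaryFunction

namespace BinaryFunction

variable {α : Type} [DecidableEq α]

lemma Linear.contract {g : BinaryFunction α} (hg : g.Linear) (e : α) :
    (g.contract e).Linear :=
  ⟨fun X hX => hg.1 X (hX.trans (Finset.erase_subset _ _)),
    fun X hX Y hY => hg.2 X (hX.trans (Finset.erase_subset _ _)) Y
      (hY.trans (Finset.erase_subset _ _))⟩

/-- The values of a deletion of a linear binary function are those of the indicator of the
projected support. -/
lemma Linear.delete_apply {g : BinaryFunction α} (hg : g.Linear) {e : α} (he : e ∈ g.E)
    {Y : Finset α} (hY : Y ⊆ g.E.erase e) :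
    (g.delete e).f Y = if g.f Y = 1 ∨ g.f (insert e Y) = 1 then 1 else 0 := by
  have hYE : Y ⊆ g.E := hY.trans (Finset.erase_subset _ _)
  have heY : e ∉ Y := fun h => Finset.notMem_erase e g.E (hY h)
  have hiE : insert e Y ⊆ g.E := Finset.insert_subset he hYE
  have hsE : {e} ⊆ g.E := Finset.singleton_subset_iff.2 he
  have hd : symmDiff Y (insert e Y) = {e} := by
    ext x; simp only [Finset.mem_symmDiff, Finset.mem_insert, Finset.mem_singleton]; grind
  have hds : symmDiff Y {e} = insert e Y := by
    ext x; simp only [Finset.mem_symmDiff, Finset.mem_insert, Finset.mem_singleton]; grind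
  have hdi : symmDiff (insert e Y) {e} = Y := by
    ext x; simp only [Finset.mem_symmDiff, Finset.mem_insert, Finset.mem_singleton]; grind
  have h₁ := hg.2 Y hYE _ hiE
  have h₂ := hg.2 Y hYE _ hsE
  have h₃ := hg.2 _ hiE _ hsE
  rw [hd] at h₁
  rw [hds] at h₂
  rw [hdi] at h₃
  have hu : Y ∪ {e} = insert e Y := by rw [Finset.union_comm, Finset.insert_eq]
  by_cases hY0 : Y = ∅
  · simp [BinaryFunction.delete, hY0, g.empty_one]
  · simp only [BinaryFunction.delete, hY0, if_false, hu]
    rcases hg.1 Y hYE with a | a <;> rcases hg.1 _ hiE with b | b <;>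
      rcases hg.1 _ hsE with c | c <;> simp_all

lemma Linear.delete {g : BinaryFunction α} (hg : g.Linear) {e : α} (he : e ∈ g.E) :
    (g.delete e).Linear := by
  constructor
  · intro X hX
    rw [hg.delete_apply he hX]
    split_ifs <;> simp
  · intro X hX Y hY h₁ h₂
    have hXY : symmDiff X Y ⊆ g.E.erase e := fun x hx => by
      rcases Finset.mem_symmDiff.1 hx with h | h
      exacts [hX h.1, hY h.1]
    have hXE : X ⊆ g.E := hX.trans (Finset.erase_subset _ _)
    have hYE : Y ⊆ g.E := hY.trans (Finset.erase_subset _ _)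
    have heX : e ∉ X := fun h => Finset.notMem_erase e g.E (hX h)
    have heY : e ∉ Y := fun h => Finset.notMem_erase e g.E (hY h)
    rw [hg.delete_apply he hX, ite_eq_left_iff] at h₁
    rw [hg.delete_apply he hY, ite_eq_left_iff] at h₂
    rw [hg.delete_apply he hXY, if_pos]
    have hX' : g.f X = 1 ∨ g.f (insert e X) = 1 := by
      by_contra h; exact zero_ne_one (h₁ h)
    have hY' : g.f Y = 1 ∨ g.f (insert e Y) = 1 := by
      by_contra h; exact zero_ne_one (h₂ h)
    have e₁ : symmDiff X (insert e Y) = insert e (symmDiff X Y) := by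
      ext x; simp only [Finset.mem_symmDiff, Finset.mem_insert]; grind
    have e₂ : symmDiff (insert e X) Y = insert e (symmDiff X Y) := by
      ext x; simp only [Finset.mem_symmDiff, Finset.mem_insert]; grind
    have e₃ : symmDiff (insert e X) (insert e Y) = symmDiff X Y := by
      ext x; simp only [Finset.mem_symmDiff, Finset.mem_insert]; grind
    have hXi := Finset.insert_subset he hXE
    have hYi := Finset.insert_subset he hYE
    rcases hX' with hx | hx <;> rcases hY' with hy | hy
    · exact .inl (hg.2 _ hXE _ hYE hx hy)
    · exact .inr (e₁ ▸ hg.2 _ hXE _ hYi hx hy)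
    · exact .inr (e₂ ▸ hg.2 _ hXi _ hYE hx hy)
    · exact .inl (e₃ ▸ hg.2 _ hXi _ hYi hx hy)

lemma fU24_not_linear {a b c d : α} (h : ({a, b, c, d} : Finset α).card = 4) :
    ¬ (fU24 a b c d).Linear := by
  intro hl
  have := hl.1 {a, b, c, d} subset_rfl
  simp only [fU24, h] at this
  norm_num at this

lemma card_erase_fU24 {a b c d e : α} (h : ({a, b, c, d} : Finset α).card = 4)
    (he : e ∈ (fU24 a b c d).E) : ((fU24 a b c d).E.erase e).card = 3 := by
  rw [Finset.card_erase_of_mem he]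
  simp [fU24, h]

lemma fU24_contract_linear {a b c d e : α} (h : ({a, b, c, d} : Finset α).card = 4)
    (he : e ∈ (fU24 a b c d).E) : ((fU24 a b c d).contract e).Linear := by
  have h3 := card_erase_fU24 h he
  have hval : ∀ X ⊆ (fU24 a b c d).E.erase e, ((fU24 a b c d).contract e).f X =
      if X = ∅ ∨ X = (fU24 a b c d).E.erase e then 1 else 0 := by
    intro X hX
    have hle := Finset.card_le_card hX
    have hfull : X = (fU24 a b c d).E.erase e ↔ X.card = 3 :=
      ⟨fun hh => hh ▸ h3, fun hh => Finset.eq_of_subset_of_card_le hX (by omega)⟩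
    rw [h3] at hle
    simp only [hfull, ← Finset.card_eq_zero]
    simp only [BinaryFunction.contract, fU24]
    grind
  constructor
  · intro X hX
    rw [hval X hX]
    split_ifs <;> simp
  · intro X hX Y hY h₁ h₂
    rw [hval X hX, ite_eq_left_iff] at h₁
    rw [hval Y hY, ite_eq_left_iff] at h₂
    have hX' : X = ∅ ∨ X = (fU24 a b c d).E.erase e := by
      by_contra h; exact zero_ne_one (h₁ h)
    have hY' : Y = ∅ ∨ Y = (fU24 a b c d).E.erase e := by
      by_contra h; exact zero_ne_one (h₂ h)
    have hXY : symmDiff X Y = ∅ ∨ symmDiff X Y = (fU24 a b c d).E.erase e := by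
      rcases hX' with rfl | rfl <;> rcases hY' with rfl | rfl <;>
        simp [← Finset.bot_eq_empty]
    rw [hval _ (by rcases hXY with h | h <;> simp [h]), if_pos hXY]

lemma fU24_delete_linear {a b c d e : α} (h : ({a, b, c, d} : Finset α).card = 4)
    (he : e ∈ (fU24 a b c d).E) : ((fU24 a b c d).delete e).Linear := by
  have h3 := card_erase_fU24 h he
  have hval : ∀ X ⊆ (fU24 a b c d).E.erase e, ((fU24 a b c d).delete e).f X =
      if Even X.card then 1 else 0 := by
    intro X hX
    have hle := Finset.card_le_card hX
    rw [h3] at hle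
    have heX : e ∉ X := fun h => Finset.notMem_erase e _ (hX h)
    have hu : (X ∪ {e}).card = X.card + 1 := by
      rw [Finset.union_comm, ← Finset.insert_eq, Finset.card_insert_of_notMem heX]
    simp only [BinaryFunction.delete, fU24, hu, ← Finset.card_eq_zero, Finset.card_singleton]
    generalize X.card = n at hle
    interval_cases n <;> norm_num [Nat.even_iff]
  constructor
  · intro X hX
    rw [hval X hX]
    split_ifs <;> simp
  · intro X hX Y hY h₁ h₂
    have hXY : symmDiff X Y ⊆ (fU24 a b c d).E.erase e := fun x hx => by
      rcases Finset.mem_symmDiff.1 hx with h | h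
      exacts [hX h.1, hY h.1]
    rw [hval X hX, ite_eq_left_iff] at h₁
    rw [hval Y hY, ite_eq_left_iff] at h₂
    have hX' : Even X.card := by
      by_contra h; exact zero_ne_one (h₁ h)
    have hY' : Even Y.card := by
      by_contra h; exact zero_ne_one (h₂ h)
    rw [hval _ hXY, if_pos]
    have hc : (symmDiff X Y).card = (X \ Y).card + (Y \ X).card :=
      Finset.card_union_of_disjoint disjoint_sdiff_sdiff
    have h₃ := Finset.card_sdiff_add_card_inter X Y
    have h₄ := Finset.card_sdiff_add_card_inter Y X
    rw [Finset.inter_comm] at h₄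
    rw [Nat.even_iff] at *
    omega

/-- If every single-element minor of `f` is linear, then so is every minor other than `f`. -/
lemma IsMinorOf.eq_or_linear {m f : BinaryFunction α} (hm : IsMinorOf m f)
    (hc : ∀ e ∈ f.E, (f.contract e).Linear) (hd : ∀ e ∈ f.E, (f.delete e).Linear) :
    m = f ∨ m.Linear := by
  induction hm with
  | refl f => exact .inl rfl
  | contract e he _ ih =>
    rcases ih hc hd with rfl | hl
    exacts [.inr (hc e he), .inr (hl.contract e)]
  | delete e he _ _ ih =>
    rcases ih hc hd with rfl | hl
    exacts [.inr (hd e he), .inr (hl.delete he)]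

end BinaryFunction

open BinaryFunction in
/-- `f_{U_{2,4}}` is an excluded minor for the linear binary functions:
it is nonlinear, but every proper minor of it is linear. -/
theorem fU24_excluded_minor {α : Type} [DecidableEq α] (a b c d : α)
    (h : ({a, b, c, d} : Finset α).card = 4) :
    ¬ (fU24 a b c d).Linear ∧
    ∀ m : BinaryFunction α, IsMinorOf m (fU24 a b c d) →
      m.E.card < (fU24 a b c d).E.card → m.Linear := by
  refine ⟨fU24_not_linear h, fun m hm hlt => ?_⟩
  rcases hm.eq_or_linear (fun _ => fU24_contract_linear h) (fun _ => fU24_delete_linear h)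
    with rfl | hl
  exacts [absurd hlt (lt_irrefl _), hl]
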